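/- Let G be a finite group and let M be a G-lattice, i.e., a representation of G on a finitely generated free ℤ-module. Then M admits a flasque resolvent: there exists a short exact sequence of G-lattices 0 → M → D → F → 0 in which D is a permutation module (the free ℤ-module on a finite G-set, with G permuting the basis) and F is flasque, meaning that for every subgroup H ≤ G the first group cohomology H¹(H, F°) vanishes, where F° = Hom_ℤ(F, ℤ) is the dual lattice with the contragredient G-action. -/

import Mathlib

open Representation in
/-- A lattice is generated, compatibly with all fixed sublattices, by a finite `G`-set of vectors:
for every subgroup `H`, the `H`-invariants are spanned by the `H`-fixed members of the family. -/
theorem Representation.exists_equivariant_family_span_fixed {k G N : Type*} [CommRing k]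
    [IsNoetherianRing k] [Group G] [Finite G] [AddCommGroup N] [Module k N] [Module.Finite k N]
    (τ : Representation k G N) :
    ∃ (n : ℕ) (σ : G →* Equiv.Perm (Fin n)) (s : Fin n → N),
      (∀ g i, s (σ g i) = τ g (s i)) ∧
      ∀ (H : Subgroup G) (x : N), (∀ h ∈ H, τ h x = x) →
        x ∈ Submodule.span k (s '' {i | ∀ h ∈ H, σ h i = i}) := by
  let I : Subgroup G → Submodule k N := fun H => invariants (τ.comp H.subtype)
  have hI : ∀ H x, x ∈ I H ↔ ∀ h ∈ H, τ h x = x := fun H x => by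
    simp [I, mem_invariants]
  choose S hS using fun H => (IsNoetherian.noetherian (I H) : (I H).FG)
  let act : MulAction G N :=
    { smul g x := τ g x
      one_smul x := by change τ 1 x = x; simp
      mul_smul g h x := by change τ (g * h) x = τ g (τ h x); simp }
  have hact : ∀ (g : G) (x : N), g • x = τ g x := fun _ _ => rfl
  let T : SubMulAction G N :=
    { carrier := ⋃ H : Subgroup G, ⋃ g : G, τ g '' (S H : Set N)
      smul_mem' g x hx := by
        simp only [Set.mem_iUnion] at hx ⊢
        obtain ⟨H, g', y, hy, rfl⟩ := hx
        exact ⟨H, g * g', y, hy, by simp [hact]⟩ }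
  have hT : (T : Set N).Finite :=
    Set.finite_iUnion fun H => Set.finite_iUnion fun g => (S H).finite_toSet.image _
  have : Finite T := hT
  let e : T ≃ Fin (Nat.card T) := Finite.equivFin T
  refine ⟨Nat.card T, (e.permCongrHom : Equiv.Perm T →* _).comp (MulAction.toPermHom G T),
    fun i => (e.symm i : N), fun g i => ?_, fun H x hx => ?_⟩
  · simp [hact]
  · have hx' : x ∈ Submodule.span k (S H : Set N) := by rw [hS]; exact (hI H x).2 hx
    refine Submodule.span_mono (fun y hy => ?_) hx'
    have hyT : y ∈ T := Set.mem_iUnion.2 ⟨H, Set.mem_iUnion.2 ⟨1, y, hy, by simp⟩⟩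
    have hyI : y ∈ I H := by rw [← hS]; exact Submodule.subset_span hy
    refine ⟨e ⟨y, hyT⟩, fun h hh => ?_, by simp⟩
    simp only [MonoidHom.comp_apply, MonoidHom.coe_coe, Equiv.permCongrHom_coe,
      Equiv.permCongr_apply, EmbeddingLike.apply_eq_iff_eq]
    exact (congrArg (MulAction.toPermHom G T h) (e.symm_apply_apply _)).trans
      (Subtype.ext ((hI H y).1 hyI h hh))

/-- Integer-valued functions on a set with an action of a finite group have no first cohomology. -/
theorem exists_eq_sub_of_isCocycle_perm {H X : Type*} [Group H] [Finite H]
    (σ : H →* Equiv.Perm X) (c : H → X → ℤ)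
    (hc : ∀ g h x, c (g * h) x = c g x + c h (σ g⁻¹ x)) :
    ∃ a : X → ℤ, ∀ g x, c g x = a (σ g⁻¹ x) - a x := by
  have := Fintype.ofFinite H
  have hpos : (Fintype.card H : ℤ) ≠ 0 := by simp
  refine ⟨fun x => -((∑ h, c h x) / Fintype.card H), fun g x => ?_⟩
  have hsum : ∑ h, c h x = ∑ h, c h (σ g⁻¹ x) + Fintype.card H * c g x := by
    rw [← Equiv.sum_comp (Equiv.mulLeft g) (fun h => c h x)]
    simp [hc, Finset.sum_add_distrib, add_comm]
  dsimp only
  rw [hsum, Int.add_mul_ediv_left _ _ hpos]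
  ring

/-- The first cohomology of a representation vanishes as soon as every crossed homomorphism is
principal. -/
theorem groupCohomology.subsingleton_one_of_forall {k G A : Type} [CommRing k] [Group G]
    [AddCommGroup A] [Module k A] (τ : Representation k G A)
    (h : ∀ f : G → A, (∀ g g', f (g * g') = τ g (f g') + f g) →
      ∃ y, ∀ g, τ g y - y = f g) :
    Subsingleton (groupCohomology (Rep.of τ) 1) := by
  refine ⟨fun x y => ?_⟩
  have key : ∀ z : groupCohomology.H1 (Rep.of τ), z = 0 := fun z => by
    induction z using groupCohomology.H1_induction_on with
    | h f =>
      rw [groupCohomology.H1π_eq_zero_iff]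
      obtain ⟨y, hy⟩ := h f ((groupCohomology.mem_cocycles₁_iff (A := Rep.of τ) _).1 f.2)
      exact ⟨y, funext hy⟩
  rw [key x, key y]

/-- If the functionals `s i` span the dual of a finite free module, then the induced map to `ι → R`
has torsion-free cokernel. -/
theorem Module.isTorsionFree_quotient_range_pi_of_span_dual_eq_top {R M ι : Type*} [CommRing R]
    [IsDomain R] [AddCommGroup M] [Module R M] [Module.Free R M] [Module.Finite R M]
    (s : ι → Module.Dual R M)
    (hs : Submodule.span R (Set.range s) = ⊤) :
    Module.IsTorsionFree R ((ι → R) ⧸ LinearMap.range (LinearMap.pi s)) := by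
  refine .of_smul_eq_zero fun k q hq => or_iff_not_imp_left.2 fun hk => ?_
  obtain ⟨v, rfl⟩ := Submodule.Quotient.mk_surjective _ q
  rw [← Submodule.Quotient.mk_smul, Submodule.Quotient.mk_eq_zero] at hq
  obtain ⟨m, hm⟩ := hq
  have hdvd : ∀ x : Module.Dual R M, k ∣ x m := fun x => by
    have hx : x ∈ Submodule.span R (Set.range s) := hs ▸ Submodule.mem_top
    induction hx using Submodule.span_induction with
    | mem x hx =>
      obtain ⟨i, rfl⟩ := hx
      exact ⟨v i, congrFun hm i⟩
    | zero => simp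
    | add x y _ _ hx hy => exact dvd_add hx hy
    | smul a x _ hx => exact hx.mul_left a
  let b := Module.Free.chooseBasis R M
  choose d hd using fun i => hdvd (b.coord i)
  have hm' : m = k • ∑ i, d i • b i := by
    conv_lhs => rw [← b.sum_repr m]
    rw [Finset.smul_sum]
    exact Finset.sum_congr rfl fun i _ => by rw [smul_smul, ← hd, b.coord_apply]
  rw [Submodule.Quotient.mk_eq_zero]
  refine ⟨∑ i, d i • b i, smul_right_injective (ι → R) hk ?_⟩
  dsimp only
  rw [← hm, ← map_smul, ← hm']

/-- Every lattice over a finite group `G` (a representation of `G` on a finitely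
generated free `ℤ`-module `M`) admits a flasque resolvent: there is a short exact
sequence of `G`-lattices `0 → M → D → F → 0` in which `D` is a permutation module
(the free `ℤ`-module `Fin n → ℤ` with `G` acting by permuting the standard basis via
`σ : G →* Equiv.Perm (Fin n)`) and `F` is flasque, i.e. for every subgroup `H ≤ G` the
first group cohomology `H¹(H, F°)` of the dual lattice `F° = Hom_ℤ(F, ℤ)` (with the
contragredient action) vanishes. -/
theorem exists_flasque_resolvent (G : Type) [Group G] [Finite G]
    (M : Type) [AddCommGroup M] [Module ℤ M] [Module.Free ℤ M] [Module.Finite ℤ M]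
    (ρ : Representation ℤ G M) :
    ∃ (n : ℕ) (σ : G →* Equiv.Perm (Fin n)) (F : ModuleCat ℤ)
      (ρF : Representation ℤ G F) (ι : M →ₗ[ℤ] (Fin n → ℤ))
      (π : (Fin n → ℤ) →ₗ[ℤ] F),
      Module.Free ℤ F ∧ Module.Finite ℤ F ∧
      Function.Injective ι ∧ Function.Surjective π ∧
      LinearMap.range ι = LinearMap.ker π ∧
      (∀ (g : G) (m : M), ι (ρ g m) = fun i => ι m ((σ g)⁻¹ i)) ∧
      (∀ (g : G) (v : Fin n → ℤ), π (fun i => v ((σ g)⁻¹ i)) = ρF g (π v)) ∧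
      ∀ H : Subgroup G,
        Subsingleton (groupCohomology (Rep.of (ρF.dual.comp H.subtype)) 1) := by
  obtain ⟨n, σ, s, hs, hfix⟩ := ρ.dual.exists_equivariant_family_span_fixed
  have hspan : Submodule.span ℤ (Set.range s) = ⊤ := eq_top_iff.2 fun x _ =>
    Submodule.span_mono (Set.image_subset_range _ _)
      (hfix ⊥ x fun h hh => by rw [Subgroup.mem_bot.1 hh, map_one]; rfl)
  have hs' : ∀ g i m, s (σ g i) m = s i (ρ g⁻¹ m) := fun g i m => by rw [hs]; rfl
  let ι : M →ₗ[ℤ] (Fin n → ℤ) := LinearMap.pi s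
  have hι : ∀ m i, ι m i = s i m := fun _ _ => rfl
  let D : Representation ℤ G (Fin n → ℤ) :=
    { toFun g := LinearMap.funLeft ℤ ℤ ⇑(σ g)⁻¹
      map_one' := by ext; simp [LinearMap.funLeft]
      map_mul' g h := by ext; simp [LinearMap.funLeft] }
  have hD : ∀ g v i, D g v i = v ((σ g)⁻¹ i) := fun _ _ _ => rfl
  have hιD : ∀ g m, ι (ρ g m) = D g (ι m) := fun g m => funext fun i => by
    rw [hD, hι, hι, ← map_inv, hs', inv_inv]
  let W := LinearMap.range ι
  have hW : ∀ g, W ≤ W.comap (D g) := by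
    rintro g _ ⟨m, rfl⟩
    exact ⟨ρ g m, hιD g m⟩
  let ρF : Representation ℤ G ((Fin n → ℤ) ⧸ W) := D.quotient W hW
  have : Module.IsTorsionFree ℤ ((Fin n → ℤ) ⧸ W) :=
    Module.isTorsionFree_quotient_range_pi_of_span_dual_eq_top s hspan
  refine ⟨n, σ, ModuleCat.of ℤ ((Fin n → ℤ) ⧸ W), ρF, ι, W.mkQ,
    inferInstanceAs (Module.Free ℤ ((Fin n → ℤ) ⧸ W)),
    inferInstanceAs (Module.Finite ℤ ((Fin n → ℤ) ⧸ W)), ?_, W.mkQ_surjective,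
    W.ker_mkQ.symm, hιD, fun g v => rfl, fun H => ?_⟩
  · refine (injective_iff_map_eq_zero ι).2 fun m hm => ?_
    refine (Module.forall_dual_apply_eq_zero_iff ℤ m).1 fun x => ?_
    have hle : Submodule.span ℤ (Set.range s) ≤ LinearMap.ker (Module.Dual.eval ℤ M m) :=
      Submodule.span_le.2 (Set.range_subset_iff.2 fun i => congrFun hm i)
    exact hle (hspan ▸ Submodule.mem_top)
  · refine groupCohomology.subsingleton_one_of_forall _ fun f hf => ?_
    change H → Module.Dual ℤ ((Fin n → ℤ) ⧸ W) at f
    have hf' : ∀ (g h : H) v, f (g * h) (W.mkQ v) =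
        f g (W.mkQ v) + f h (W.mkQ (D (g : G)⁻¹ v)) := fun g h v => by
      rw [hf, add_comm]; rfl
    let p : Fin n → (Fin n → ℤ) ⧸ W := fun i => W.mkQ (Pi.single i 1)
    have hDp : ∀ (g : G) i, D g⁻¹ (Pi.single i 1) = Pi.single (σ g⁻¹ i) 1 := fun g i => by
      ext j
      rw [hD, Pi.single_apply, Pi.single_apply]
      simp [Equiv.eq_symm_apply, eq_comm]
    have hfp : ∀ (g : H) v, f g (W.mkQ v) = ∑ i, v i * f g (p i) := fun g v => by
      refine ((f g ∘ₗ W.mkQ).pi_apply_eq_sum_univ v).trans (Finset.sum_congr rfl fun i _ => ?_)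
      have hi : (fun j => if i = j then 1 else 0 : Fin n → ℤ) = Pi.single i 1 := by
        ext j
        simp [Pi.single_apply, eq_comm]
      rw [hi]; rfl
    obtain ⟨a, ha⟩ := exists_eq_sub_of_isCocycle_perm (σ.comp H.subtype)
      (fun g i => f g (p i)) fun g h i => by
        dsimp only [p]
        rw [hf', hDp]; rfl
    simp only [MonoidHom.comp_apply, Subgroup.subtype_apply, map_inv] at ha
    have hsum : ∀ (g : H) (a : Fin n → ℤ) (v : Fin n → ℤ),
        ∑ i, a i * v (σ g i) = ∑ i, a ((σ g)⁻¹ i) * v i := fun g a v => by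
      rw [← Equiv.sum_comp (σ g) (fun i => a ((σ g)⁻¹ i) * v i)]
      simp
    let E : (Fin n → ℤ) → (Fin n → ℤ) →ₗ[ℤ] ℤ := fun a => ∑ i, a i • LinearMap.proj i
    have hE : ∀ a v, E a v = ∑ i, a i * v i := fun a v => by simp [E]
    have hEσ : ∀ (g : H) (a v : Fin n → ℤ),
        E a (D (g : G)⁻¹ v) = E (fun i => a ((σ g)⁻¹ i)) v := fun g a v => by
      rw [hE, hE, ← hsum]
      simp [hD]
    have hdiff : ∀ (g : H) (v : Fin n → ℤ),
        f g (W.mkQ v) = E (fun i => a ((σ g)⁻¹ i)) v - E a v := fun g v => by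
      rw [hfp, hE, hE, ← Finset.sum_sub_distrib]
      exact Finset.sum_congr rfl fun i _ => by rw [ha]; ring
    have hmem := hfix H (E a ∘ₗ ι) fun h hh => LinearMap.ext fun m => by
      change E a (ι (ρ h⁻¹ m)) = E a (ι m)
      rw [hιD, hEσ ⟨h, hh⟩, ← sub_eq_zero, ← hdiff,
        show W.mkQ (ι m) = 0 from (Submodule.Quotient.mk_eq_zero W).2 ⟨m, rfl⟩, map_zero]
    obtain ⟨b, hb, hbs⟩ := (Finsupp.mem_span_image_iff_linearCombination ℤ).1 hmem
    have hbσ : ∀ (h : H) i, b ((σ h)⁻¹ i) = b i := fun h i => by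
      by_cases hi : ∀ h ∈ H, σ h i = i
      · rw [← map_inv, hi _ (inv_mem h.2)]
      · have hi' : ¬ ∀ h' ∈ H, σ h' ((σ h)⁻¹ i) = (σ h)⁻¹ i := fun hi' => hi <| by
          have := hi' h h.2
          rw [← Equiv.Perm.mul_apply, mul_inv_cancel, Equiv.Perm.one_apply] at this
          rwa [← this] at hi'
        rw [Finsupp.notMem_support_iff.1 fun h' => hi (hb h'),
          Finsupp.notMem_support_iff.1 fun h' => hi' (hb h')]
    have hker : W ≤ LinearMap.ker (E (a - b)) := by
      rintro _ ⟨m, rfl⟩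
      have := LinearMap.congr_fun hbs m
      rw [Finsupp.linearCombination_apply, Finsupp.sum_fintype _ _ (by simp),
        LinearMap.sum_apply, LinearMap.comp_apply, hE] at this
      rw [LinearMap.mem_ker, hE]
      simp only [Pi.sub_apply, sub_mul, Finset.sum_sub_distrib, ← this, sub_eq_zero]
      rfl
    refine ⟨W.liftQ _ hker, fun g => W.linearMap_qext <| LinearMap.ext fun v => ?_⟩
    change E (a - b) (D (g : G)⁻¹ v) - E (a - b) v = f g (W.mkQ v)
    rw [hEσ, hdiff, hE, hE, hE, hE, ← Finset.sum_sub_distrib, ← Finset.sum_sub_distrib]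
    refine Finset.sum_congr rfl fun i _ => ?_
    simp only [Pi.sub_apply, hbσ]
    ring
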